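/- Let M′ be the L₁-structure described in the context and T′ = Th(M′). Then there exists an automorphism σ₀ of M′ such that the theory T′_aut(M′,σ₀) — namely T′_aut together with the elementary diagram of M′ (in the language L₁ expanded by a constant c_a for each element a of M′) and the sentences σ(c_a) = c_{σ₀(a)} for every a in M′ — has a model completion. -/

import Mathlib

universe u v w

namespace FirstOrder

open Language Structure

namespace ShelahE34

/-- The index type for the function symbols of the language consisting of a single
unary function symbol `σ`. -/
inductive SigmaFunc : ℕ → Type
  | sigma : SigmaFunc 1

/-- The language consisting of a single unary function symbol `σ`. -/
def sigmaLang : Language.{0, 0} :=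
  ⟨SigmaFunc, fun _ => Empty⟩

/-- `L⁺`: the language `L` expanded by one new unary function symbol `σ`. -/
abbrev LPlus (L : Language.{u, v}) : Language :=
  L.sum sigmaLang

/-- The new unary function symbol `σ` of `L⁺`. -/
def sigmaSymb (L : Language.{u, v}) : (LPlus L).Functions 1 :=
  Sum.inr SigmaFunc.sigma

/-- Application of the symbol `σ` to a term of `L⁺`. -/
def sigmaTerm {L : Language.{u, v}} {α : Type w} (t : (LPlus L).Term α) : (LPlus L).Term α :=
  Functions.apply₁ (sigmaSymb L) t

/-- The interpretation of the symbol `σ` in an `L⁺`-structure, as a function. -/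
def sigmaMap (L : Language.{u, v}) (N : Type w) [(LPlus L).Structure N] : N → N :=
  fun x => funMap (sigmaSymb L) ![x]

/-- The sentence `(∀x)(∀y)(σ(x) = σ(y) → x = y)`. -/
def sigmaInj (L : Language.{u, v}) : (LPlus L).Sentence :=
  ∀' ∀' ((sigmaTerm (&0) =' sigmaTerm (&1)) ⟹ ((&0) =' (&1)))

/-- The sentence `(∀y)(∃x)(σ(x) = y)`. -/
def sigmaSurj (L : Language.{u, v}) : (LPlus L).Sentence :=
  ∀' ∃' (sigmaTerm (&1) =' (&0))

/-- The sentence `(∀x̄)(F(σ(x̄)) = σ(F(x̄)))` for a function symbol `F` of `L`. -/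
def funCommSentence (L : Language.{u, v}) {n : ℕ} (F : L.Functions n) : (LPlus L).Sentence :=
  BoundedFormula.alls
    (sigmaTerm (Term.func (Sum.inl F : (LPlus L).Functions n) fun i => Term.var (Sum.inr i)) ='
      Term.func (Sum.inl F : (LPlus L).Functions n) fun i => sigmaTerm (Term.var (Sum.inr i)))

/-- The sentence `(∀x̄)(R(x̄) ↔ R(σ(x̄)))` for a relation symbol `R` of `L`. -/
def relPresSentence (L : Language.{u, v}) {n : ℕ} (R : L.Relations n) : (LPlus L).Sentence :=
  BoundedFormula.alls
    ((Relations.boundedFormula (Sum.inl R : (LPlus L).Relations n)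
        fun i => Term.var (Sum.inr i)) ⇔
      Relations.boundedFormula (Sum.inl R : (LPlus L).Relations n)
        fun i => sigmaTerm (Term.var (Sum.inr i)))

/-- `T_aut`: the `L⁺`-theory consisting of `T` together with the sentences asserting that `σ`
is an automorphism. -/
def Taut {L : Language.{u, v}} (T : L.Theory) : (LPlus L).Theory :=
  (LHom.sumInl : L →ᴸ LPlus L).onTheory T ∪ {sigmaInj L, sigmaSurj L} ∪
    {φ | ∃ (n : ℕ) (F : L.Functions n), φ = funCommSentence L F} ∪
    {φ | ∃ (n : ℕ) (R : L.Relations n), φ = relPresSentence L R}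

/-- A theory is complete and consistent if it is satisfiable and semantically decides every
sentence. -/
def SemComplete {L' : Language.{u, v}} (U : L'.Theory) : Prop :=
  U.IsSatisfiable ∧ ∀ φ : L'.Sentence, U ⊨ᵇ φ ∨ U ⊨ᵇ ∼φ

/-- A completion of a theory `S`: a complete consistent theory in the same language
containing `S`. -/
def IsCompletionOf {L' : Language.{u, v}} (S U : L'.Theory) : Prop :=
  S ⊆ U ∧ SemComplete U

/-- The atomic diagram of a structure `M`: all atomic and negated atomic sentences with
constants from `M` that hold in `M`. -/
def atomicDiagram (L' : Language.{u, v}) (M : Type w) [L'.Structure M] : (L'[[M]]).Theory :=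
  {φ | (φ.IsAtomic ∨ ∃ ψ : (L'[[M]]).Sentence, ψ.IsAtomic ∧ φ = ∼ψ) ∧ M ⊨ φ}

/-- `Tstar` is a model completion of `S`: it contains `S`, every model of `S` embeds into a
model of `Tstar`, and for every model `M` of `S`, `Tstar` together with the atomic diagram of
`M` is a complete consistent theory. -/
def IsModelCompletion.{u', v', w'} {L' : Language.{u', v'}} (S Tstar : L'.Theory) : Prop :=
  S ⊆ Tstar ∧
    (∀ M : Theory.ModelType.{u', v', w'} S, ∃ N : Theory.ModelType.{u', v', w'} Tstar,
      Nonempty (M ↪[L'] N)) ∧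
    ∀ M : Theory.ModelType.{u', v', w'} S,
      SemComplete ((L'.lhomWithConstants M).onTheory Tstar ∪ atomicDiagram L' M)

/-- The relation symbols of the language `L₁`: binary symbols `Eₙ` (`n ∈ ℕ`), `E` and `E⁎`,
and unary symbols `Pₘ` (`m ∈ ℕ`). -/
inductive L1Rel : ℕ → Type
  | En : ℕ → L1Rel 2
  | E : L1Rel 2
  | Estar : L1Rel 2
  | P : ℕ → L1Rel 1

/-- The language `L₁` (a relational language). -/
def L1 : Language.{0, 0} :=
  ⟨fun _ => Empty, L1Rel⟩

/-- The universe of the structure `M′`: quadruples `(η, k, n, ℓ)` with `η ∈ 2^ℕ`,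
`k, n ∈ ℕ`, `ℓ ∈ {0, 1}` (as a Boolean). -/
def M1Point : Type :=
  (ℕ → Bool) × ℕ × ℕ × Bool

instance : Nonempty M1Point :=
  ⟨⟨fun _ => false, 0, 0, false⟩⟩

/-- The `L₁`-structure `M′`. -/
instance L1StructureM1Point : L1.Structure M1Point where
  funMap f _ := f.elim
  RelMap {m} r x :=
    match r, x with
    | .En n, x => ∀ i < n, (x 0).1 i = (x 1).1 i
    | .E, x => (x 0).1 = (x 1).1 ∧ (x 0).2.1 = (x 1).2.1
    | .Estar, x => (x 0).1 = (x 1).1 ∧ (x 0).2.1 = (x 1).2.1 ∧ (x 0).2.2.1 = (x 1).2.2.1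
    | .P m, x => (x 0).2.2.1 = m

/-- The sentence `σ(c_a) = c_{σ₀(a)}` in the language `L₁⁺` with constants for the elements
of `M′`. -/
def sigmaConstSentence (σ₀ : M1Point ≃[L1] M1Point) (a : M1Point) :
    ((LPlus L1)[[M1Point]]).Sentence :=
  Term.equal
    (Functions.apply₁
      (Sum.inl (sigmaSymb L1) : ((LPlus L1)[[M1Point]]).Functions 1)
      (Constants.term ((LPlus L1).con a)))
    (Constants.term ((LPlus L1).con (σ₀ a)))

/-- The theory `T′_aut(M′, σ₀)`: `T′_aut` together with the elementary diagram of `M′` and the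
sentences `σ(c_a) = c_{σ₀(a)}` for every `a ∈ M′`. -/
def TautDiag (σ₀ : M1Point ≃[L1] M1Point) : ((LPlus L1)[[M1Point]]).Theory :=
  ((LPlus L1).lhomWithConstants M1Point).onTheory (Taut (L1.completeTheory M1Point)) ∪
    ((LHom.sumInl : L1 →ᴸ LPlus L1).addConstants M1Point).onTheory
      (L1.elementaryDiagram M1Point) ∪
    {φ | ∃ a : M1Point, φ = sigmaConstSentence σ₀ a}

/-! ### The odometer -/

/-- The number coded by the first `n` bits of `η`. -/
def valN (η : ℕ → Bool) : ℕ → ℕ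
  | 0 => 0
  | n + 1 => valN η n + if η n then 2 ^ n else 0

theorem valN_lt (η : ℕ → Bool) (n : ℕ) : valN η n < 2 ^ n := by
  induction n with
  | zero => simp [valN]
  | succ n ih => simp only [valN, pow_succ]; split <;> omega

theorem valN_inj (η θ : ℕ → Bool) (n : ℕ) : valN η n = valN θ n ↔ ∀ i < n, η i = θ i := by
  induction n with
  | zero => simp [valN]
  | succ n ih =>
    have h1 := valN_lt η n
    have h2 := valN_lt θ n
    have : valN η (n+1) = valN θ (n+1) ↔ (valN η n = valN θ n ∧ η n = θ n) := by
      simp only [valN]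
      cases η n <;> cases θ n <;> simp <;> omega
    rw [this, ih]
    constructor
    · rintro ⟨h, h'⟩ i hi
      rcases Nat.lt_succ_iff_lt_or_eq.1 hi with h3 | rfl
      · exact h i h3
      · exact h'
    · intro h
      exact ⟨fun i hi => h i (by omega), h n (by omega)⟩

/-- The residue modulo `2 ^ n` coded by the first `n` bits of `η`. -/
def val (η : ℕ → Bool) (n : ℕ) : ZMod (2 ^ n) := (valN η n : ZMod (2 ^ n))

theorem val_inj (η θ : ℕ → Bool) (n : ℕ) : val η n = val θ n ↔ ∀ i < n, η i = θ i := by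
  rw [← valN_inj, val, val, ZMod.natCast_eq_natCast_iff', Nat.mod_eq_of_lt (valN_lt _ _),
    Nat.mod_eq_of_lt (valN_lt _ _)]

/-- All bits of `η` below `n` are equal to `b`. -/
def allB (b : Bool) (η : ℕ → Bool) : ℕ → Bool
  | 0 => true
  | n + 1 => allB b η n && (η n == b)

/-- The odometer. -/
def odo (b : Bool) (η : ℕ → Bool) : ℕ → Bool := fun i => xor (η i) (allB b η i)

theorem allB_odo (b : Bool) (η : ℕ → Bool) (n : ℕ) : allB (!b) (odo b η) n = allB b η n := by
  induction n with
  | zero => rfl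
  | succ n ih =>
    simp only [allB, ih, odo]
    cases allB b η n <;> cases η n <;> cases b <;> rfl

theorem odo_odo (b : Bool) (η : ℕ → Bool) : odo (!b) (odo b η) = η := by
  funext i
  have : odo (!b) (odo b η) i = xor (odo b η i) (allB (!b) (odo b η) i) := rfl
  rw [this, allB_odo, odo]
  simp

theorem allB_congr (b : Bool) (η θ : ℕ → Bool) (n : ℕ) (h : ∀ i < n, η i = θ i) :
    allB b η n = allB b θ n := by
  induction n with
  | zero => rfl
  | succ n ih => simp only [allB, ih (fun i hi => h i (by omega)), h n (by omega)]

theorem odo_congr (b : Bool) (η θ : ℕ → Bool) (n : ℕ) (h : ∀ i < n, η i = θ i) :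
    ∀ i < n, odo b η i = odo b θ i := by
  intro i hi
  simp only [odo, h i hi, allB_congr b η θ i (fun j hj => h j (by omega))]

theorem odo_congr_iff (b : Bool) (η θ : ℕ → Bool) (n : ℕ) :
    (∀ i < n, odo b η i = odo b θ i) ↔ (∀ i < n, η i = θ i) := by
  constructor
  · intro h
    have := odo_congr (!b) _ _ n h
    rwa [odo_odo, odo_odo] at this
  · exact odo_congr b η θ n

theorem odo_inj (b : Bool) (η θ : ℕ → Bool) : odo b η = odo b θ ↔ η = θ := by
  constructor
  · intro h
    rw [← odo_odo b η, h, odo_odo]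
  · rintro rfl; rfl

theorem valN_odo (η : ℕ → Bool) (n : ℕ) :
    valN (odo true η) n + (if allB true η n then 2 ^ n else 0) = valN η n + 1 := by
  induction n with
  | zero => simp [valN, allB]
  | succ n ih =>
    have h1 : odo true η n = xor (η n) (allB true η n) := rfl
    simp only [valN, allB, h1, pow_succ]
    cases h2 : allB true η n <;> cases h3 : η n <;> simp [h2] at ih ⊢ <;> omega

theorem val_odo (η : ℕ → Bool) (n : ℕ) : val (odo true η) n = val η n + 1 := by
  have h := congrArg (Nat.cast : ℕ → ZMod (2 ^ n)) (valN_odo η n)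
  have h0 : ((2 ^ n : ℕ) : ZMod (2 ^ n)) = 0 := ZMod.natCast_self _
  push_cast at h h0
  simpa [val, h0] using h

/-! ### Combinatorial description of the models -/

/-- The combinatorial data of a model of the theory. -/
structure Nice (A : Type u) where
  s : Equiv.Perm A
  V : ∀ n : ℕ, A → ZMod (2 ^ n)
  E : A → A → Prop
  Es : A → A → Prop
  P : ℕ → A → Prop
  pt : A → A
  cst : (ℕ → Bool) → ℕ → A
  eqE : Equivalence E
  eqEs : Equivalence Es
  Es_E : ∀ x y, Es x y → E x y
  E_V : ∀ x y n, E x y → V n x = V n y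
  V_s : ∀ x n, V n (s x) = V n x + 1
  E_s : ∀ x y, E (s x) (s y) ↔ E x y
  Es_s : ∀ x y, Es (s x) (s y) ↔ Es x y
  P_s : ∀ m x, P m (s x) ↔ P m x
  P_Es : ∀ m x y, Es x y → P m x → P m y
  P_E : ∀ m x y, E x y → P m x → P m y → Es x y
  P_disj : ∀ m k x, P m x → P k x → m = k
  P_ex : ∀ m x, ∃ y, E x y ∧ P m y
  Es_pt : ∀ x y, Es x y ↔ y = x ∨ y = pt x
  pt_ne : ∀ x, pt x ≠ x
  V_cst : ∀ η k n, V n (cst η k) = val η n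
  cst_ne : ∀ η k θ l (j : ℤ), E (cst η k) ((s ^ j) (cst θ l)) → k = l
  V_sur : ∀ x K, ∃ η, ∀ m ≤ K, V m x = val η m

namespace Nice

variable {A B : Type u} (NA : Nice A) (NB : Nice B)

theorem zind {p : ℤ → Prop} (h0 : p 0) (h1 : ∀ n, p n ↔ p (n + 1)) (n : ℤ) : p n := by
  induction n using Int.induction_on with
  | zero => exact h0
  | succ i hi => exact (h1 _).1 hi
  | pred i hi => exact (h1 _).2 (by simpa using hi)

theorem s_add_one (k : ℤ) (x : A) : (NA.s ^ (k + 1)) x = NA.s ((NA.s ^ k) x) := by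
  rw [add_comm, zpow_add, zpow_one]; rfl

theorem s_add (k l : ℤ) (x : A) : (NA.s ^ (k + l)) x = (NA.s ^ k) ((NA.s ^ l) x) := by
  rw [zpow_add]; rfl

theorem V_z (k : ℤ) (x : A) (n : ℕ) : NA.V n ((NA.s ^ k) x) = NA.V n x + k := by
  revert k
  refine zind (by simp) fun k => ?_
  rw [s_add_one, V_s]
  push_cast
  rw [← add_assoc, add_left_inj]

theorem E_z (k : ℤ) (x y : A) : NA.E ((NA.s ^ k) x) ((NA.s ^ k) y) ↔ NA.E x y := by
  revert k
  refine zind (by simp) fun k => ?_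
  rw [s_add_one, s_add_one, E_s]

theorem Es_z (k : ℤ) (x y : A) : NA.Es ((NA.s ^ k) x) ((NA.s ^ k) y) ↔ NA.Es x y := by
  revert k
  refine zind (by simp) fun k => ?_
  rw [s_add_one, s_add_one, Es_s]

theorem P_z (k : ℤ) (m : ℕ) (x : A) : NA.P m ((NA.s ^ k) x) ↔ NA.P m x := by
  revert k
  refine zind (by simp) fun k => ?_
  rw [s_add_one, P_s]

theorem E_free (k : ℤ) (x : A) (h : NA.E x ((NA.s ^ k) x)) : k = 0 := by
  have h1 : ∀ n : ℕ, ((2 ^ n : ℕ) : ℤ) ∣ k := by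
    intro n
    have := NA.E_V _ _ n h
    rw [V_z] at this
    rw [← ZMod.intCast_zmod_eq_zero_iff_dvd]
    simpa using this.symm
  by_contra hk
  have := Int.natAbs_dvd_natAbs.2 (h1 k.natAbs)
  have := Nat.le_of_dvd (by omega) this
  have h3 := Nat.lt_two_pow_self (n := k.natAbs)
  simp at this
  omega

theorem neg_cancel_apply (s : Equiv.Perm A) (k : ℤ) (y : A) : (s ^ (-k)) ((s ^ k) y) = y := by
  rw [← Equiv.Perm.mul_apply, ← zpow_add]; simp

/-- Relation pattern shared by `E`, `Es` and equality. -/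
structure Inv (s : Equiv.Perm A) (R : A → A → Prop) : Prop where
  symm : ∀ x y, R x y → R y x
  z : ∀ (k : ℤ) x y, R ((s ^ k) x) ((s ^ k) y) ↔ R x y

theorem Inv.flip {s : Equiv.Perm A} {R : A → A → Prop} (h : Inv s R) (k : ℤ) (x y : A) :
    R x ((s ^ k) y) ↔ R y ((s ^ (-k)) x) := by
  rw [← h.z (-k), neg_cancel_apply]
  exact ⟨h.symm _ _, h.symm _ _⟩

theorem Inv.two {s : Equiv.Perm A} {R : A → A → Prop} (h : Inv s R) (k l : ℤ) (x y : A) :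
    R ((s ^ k) x) ((s ^ l) y) ↔ R x ((s ^ (l - k)) y) := by
  rw [← h.z (-k), ← Equiv.Perm.mul_apply, ← Equiv.Perm.mul_apply, ← zpow_add, ← zpow_add]
  simp [neg_add_eq_sub]

theorem invE : Inv NA.s NA.E := ⟨fun _ _ h => NA.eqE.symm h, NA.E_z⟩
theorem invEs : Inv NA.s NA.Es := ⟨fun _ _ h => NA.eqEs.symm h, NA.Es_z⟩
theorem invEq : Inv NA.s (fun x y => x = y) := ⟨fun _ _ h => h.symm, fun _ _ _ => by simp⟩

/-- `S` is a partial isomorphism at level `K`. -/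
structure Good (K : ℕ) (S : Set (A × B)) : Prop where
  V : ∀ p ∈ S, ∀ m ≤ K, NA.V m p.1 = NB.V m p.2
  P : ∀ p ∈ S, ∀ m < K, NA.P m p.1 ↔ NB.P m p.2
  E : ∀ p ∈ S, ∀ q ∈ S, ∀ k : ℤ, NA.E p.1 ((NA.s ^ k) q.1) ↔ NB.E p.2 ((NB.s ^ k) q.2)
  Es : ∀ p ∈ S, ∀ q ∈ S, ∀ k : ℤ, NA.Es p.1 ((NA.s ^ k) q.1) ↔ NB.Es p.2 ((NB.s ^ k) q.2)
  eq : ∀ p ∈ S, ∀ q ∈ S, ∀ k : ℤ, p.1 = ((NA.s ^ k) q.1) ↔ p.2 = ((NB.s ^ k) q.2)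

variable {NA NB}

theorem pairs_insert {sA : Equiv.Perm A} {sB : Equiv.Perm B} {R : A → A → Prop}
    {R' : B → B → Prop} (hR : Inv sA R) (hR' : Inv sB R') (S : Set (A × B))
    (h : ∀ p ∈ S, ∀ q ∈ S, ∀ k : ℤ, R p.1 ((sA ^ k) q.1) ↔ R' p.2 ((sB ^ k) q.2)) (a : A) (b : B)
    (h1 : ∀ q ∈ S, ∀ k : ℤ, R a ((sA ^ k) q.1) ↔ R' b ((sB ^ k) q.2))
    (h2 : ∀ k : ℤ, R a ((sA ^ k) a) ↔ R' b ((sB ^ k) b)) :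
    ∀ p ∈ insert (a, b) S, ∀ q ∈ insert (a, b) S, ∀ k : ℤ,
      R p.1 ((sA ^ k) q.1) ↔ R' p.2 ((sB ^ k) q.2) := by
  rintro p (rfl | hp) q (rfl | hq) k
  · exact h2 k
  · exact h1 q hq k
  · rw [hR.flip, hR'.flip]; exact h1 p hp (-k)
  · exact h p hp q hq k

theorem Good.insert {K : ℕ} {S : Set (A × B)} (hS : Good NA NB K S) (a : A) (b : B)
    (hV : ∀ m ≤ K, NA.V m a = NB.V m b) (hP : ∀ m < K, NA.P m a ↔ NB.P m b)
    (hE : ∀ q ∈ S, ∀ k : ℤ, NA.E a ((NA.s ^ k) q.1) ↔ NB.E b ((NB.s ^ k) q.2))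
    (hEs : ∀ q ∈ S, ∀ k : ℤ, NA.Es a ((NA.s ^ k) q.1) ↔ NB.Es b ((NB.s ^ k) q.2))
    (heq : ∀ q ∈ S, ∀ k : ℤ, a = ((NA.s ^ k) q.1) ↔ b = ((NB.s ^ k) q.2)) :
    Good NA NB K (insert (a, b) S) where
  V := by
    rintro p (rfl | hp)
    · exact hV
    · exact hS.V p hp
  P := by
    rintro p (rfl | hp)
    · exact hP
    · exact hS.P p hp
  E := by
    refine pairs_insert NA.invE NB.invE S hS.E a b hE fun k => ?_
    constructor
    · intro h; obtain rfl := NA.E_free _ _ h; exact NB.eqE.refl _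
    · intro h; obtain rfl := NB.E_free _ _ h; exact NA.eqE.refl _
  Es := by
    refine pairs_insert NA.invEs NB.invEs S hS.Es a b hEs fun k => ?_
    constructor
    · intro h; obtain rfl := NA.E_free _ _ (NA.Es_E _ _ h); exact NB.eqEs.refl _
    · intro h; obtain rfl := NB.E_free _ _ (NB.Es_E _ _ h); exact NA.eqEs.refl _
  eq := by
    refine pairs_insert NA.invEq NB.invEq S hS.eq a b heq fun k => ?_
    constructor
    · intro h
      have := NA.eqE.refl a
      nth_rw 2 [h] at this
      obtain rfl := NA.E_free _ _ this; rfl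
    · intro h
      have := NB.eqE.refl b
      nth_rw 2 [h] at this
      obtain rfl := NB.E_free _ _ this; rfl

theorem eq_pt_iff (NA : Nice A) (x y : A) : NA.pt x = y ↔ NA.Es x y ∧ x ≠ y := by
  rw [Es_pt]
  constructor
  · rintro rfl
    exact ⟨Or.inr rfl, (NA.pt_ne x).symm⟩
  · rintro ⟨h | h, h'⟩
    · exact absurd h.symm h'
    · exact h.symm

theorem Equivalence.congr_left {R : A → A → Prop} (h : Equivalence R) {x y z : A} (hxy : R x y) :
    R x z ↔ R y z := ⟨fun h1 => h.trans (h.symm hxy) h1, fun h1 => h.trans hxy h1⟩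

theorem Good.forth {K : ℕ} {S : Set (A × B)} (hS : Good NA NB K S) (hf : S.Finite) (a : A) :
    ∃ b, Good NA NB K (Insert.insert (a, b) S) := by
  by_cases h1 : ∃ q ∈ S, ∃ k : ℤ, NA.Es a ((NA.s ^ k) q.1)
  · obtain ⟨q, hq, k, hk⟩ := h1
    obtain ⟨b, hb, hb'⟩ : ∃ b, NB.Es b ((NB.s ^ k) q.2) ∧
        (∀ r ∈ S, ∀ l : ℤ, a = (NA.s ^ l) r.1 ↔ b = (NB.s ^ l) r.2) := by
      have hk' := NA.eqEs.symm hk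
      rw [Es_pt] at hk'
      rcases hk' with hk' | hk'
      · refine ⟨_, NB.eqEs.refl _, fun r hr l => ?_⟩
        rw [hk', NA.invEq.two, NB.invEq.two]
        exact hS.eq q hq r hr _
      · refine ⟨NB.pt ((NB.s ^ k) q.2), NB.eqEs.symm ((NB.Es_pt _ _).2 (Or.inr rfl)),
          fun r hr l => ?_⟩
        rw [hk', eq_pt_iff, eq_pt_iff, Ne, Ne, NA.invEq.two, NB.invEq.two, NA.invEs.two,
          NB.invEs.two, hS.eq q hq r hr _, hS.Es q hq r hr]
    refine ⟨b, hS.insert a b ?_ ?_ ?_ ?_ hb'⟩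
    · intro m hm
      rw [NA.E_V _ _ m (NA.Es_E _ _ hk), NB.E_V _ _ m (NB.Es_E _ _ hb), V_z, V_z, hS.V q hq m hm]
    · intro m hm
      have e1 : NA.P m a ↔ NA.P m q.1 := by
        rw [← NA.P_z k m q.1]
        exact ⟨NA.P_Es _ _ _ hk, NA.P_Es _ _ _ (NA.eqEs.symm hk)⟩
      have e2 : NB.P m b ↔ NB.P m q.2 := by
        rw [← NB.P_z k m q.2]
        exact ⟨NB.P_Es _ _ _ hb, NB.P_Es _ _ _ (NB.eqEs.symm hb)⟩
      rw [e1, e2, hS.P q hq m hm]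
    · intro r hr l
      rw [Equivalence.congr_left NA.eqE (NA.Es_E _ _ hk),
        Equivalence.congr_left NB.eqE (NB.Es_E _ _ hb), NA.invE.two, NB.invE.two, hS.E q hq r hr]
    · intro r hr l
      rw [Equivalence.congr_left NA.eqEs hk,
        Equivalence.congr_left NB.eqEs hb, NA.invEs.two, NB.invEs.two, hS.Es q hq r hr]
  · push Not at h1
    obtain ⟨b₀, hbV, hbE⟩ : ∃ b₀, (∀ m ≤ K, NA.V m a = NB.V m b₀) ∧
        ∀ q ∈ S, ∀ k : ℤ, NA.E a ((NA.s ^ k) q.1) ↔ NB.E b₀ ((NB.s ^ k) q.2) := by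
      by_cases h2 : ∃ q ∈ S, ∃ k : ℤ, NA.E a ((NA.s ^ k) q.1)
      · obtain ⟨q, hq, k, hk⟩ := h2
        refine ⟨(NB.s ^ k) q.2, ?_, ?_⟩
        · intro m hm
          rw [NA.E_V _ _ m hk, V_z, V_z, hS.V q hq m hm]
        · intro r hr l
          rw [Equivalence.congr_left NA.eqE hk, NA.invE.two, NB.invE.two, hS.E q hq r hr]
      · push Not at h2
        obtain ⟨η, hη⟩ := NA.V_sur a K
        have hfin : {k : ℕ | ∃ q ∈ S, ∃ j : ℤ, NB.E (NB.cst η k) ((NB.s ^ j) q.2)}.Finite := by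
          have : {k : ℕ | ∃ q ∈ S, ∃ j : ℤ, NB.E (NB.cst η k) ((NB.s ^ j) q.2)} =
              ⋃ q ∈ S, {k : ℕ | ∃ j : ℤ, NB.E (NB.cst η k) ((NB.s ^ j) q.2)} := by
            ext; simp
          rw [this]
          refine hf.biUnion fun q _ => Set.Subsingleton.finite ?_
          rintro k ⟨j, hj⟩ l ⟨i, hi⟩
          rw [NB.invE.flip] at hi
          have hj' := (NB.E_z (-j) _ _).2 hj
          rw [neg_cancel_apply] at hj'
          have := NB.eqE.trans hj' hi
          rw [NB.invE.two] at this
          exact NB.cst_ne _ _ _ _ _ this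
        obtain ⟨k, hk⟩ := hfin.exists_notMem
        refine ⟨NB.cst η k, ?_, ?_⟩
        · intro m hm
          rw [hη m hm, V_cst]
        · intro q hq j
          simp only [h2 q hq j, false_iff]
          intro h
          exact hk ⟨q, hq, j, h⟩
    obtain ⟨m', hm'P, hm'⟩ : ∃ m', (∀ m < K, NA.P m a ↔ m = m') ∧
        ∀ q ∈ S, ∀ k : ℤ, NA.E a ((NA.s ^ k) q.1) → ¬ NB.P m' q.2 := by
      by_cases h3 : ∃ m < K, NA.P m a
      · obtain ⟨m, hm, hma⟩ := h3
        refine ⟨m, ?_, ?_⟩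
        · intro j _
          constructor
          · intro h; exact NA.P_disj _ _ _ h hma
          · rintro rfl; exact hma
        · intro q hq k hk hP
          rw [← hS.P q hq m hm, ← NA.P_z k] at hP
          exact h1 q hq k (NA.P_E _ _ _ hk hma hP)
      · push Not at h3
        have hfin : (⋃ q ∈ S, {m | NB.P m q.2}).Finite :=
          hf.biUnion fun q _ => Set.Subsingleton.finite fun m hm k hk => NB.P_disj _ _ _ hm hk
        obtain ⟨m, hm⟩ := (hfin.union (Set.finite_lt_nat K)).exists_notMem
        simp only [Set.mem_union, Set.mem_iUnion, Set.mem_ofPred_eq, not_or, not_exists] at hm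
        refine ⟨m, fun j hj => ?_, fun q hq _ _ => hm.1 q hq⟩
        simp only [h3 j hj, false_iff]
        rintro rfl
        exact hm.2 hj
    obtain ⟨b, hb, hbP⟩ := NB.P_ex m' b₀
    have hbs : ∀ q ∈ S, ∀ k : ℤ, ¬ NB.Es b ((NB.s ^ k) q.2) := by
      intro q hq k h
      refine hm' q hq k ?_ ((NB.P_z k _ _).1 (NB.P_Es _ _ _ h hbP))
      rw [hbE q hq k]
      exact NB.eqE.trans hb (NB.Es_E _ _ h)
    refine ⟨b, hS.insert a b ?_ ?_ ?_ ?_ ?_⟩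
    · intro m hm
      rw [hbV m hm, NB.E_V _ _ m hb]
    · intro m hm
      rw [hm'P m hm]
      constructor
      · rintro rfl; exact hbP
      · intro h; exact NB.P_disj _ _ _ h hbP
    · intro q hq k
      rw [hbE q hq k, Equivalence.congr_left NB.eqE hb]
    · intro q hq k
      simp only [h1 q hq k, hbs q hq k]
    · intro q hq k
      constructor
      · intro h
        exact absurd (by rw [← h]; exact NA.eqEs.refl _) (h1 q hq k)
      · intro h
        exact absurd (by rw [← h]; exact NB.eqEs.refl _) (hbs q hq k)

theorem Good.swap {K : ℕ} {S : Set (A × B)} (hS : Good NA NB K S) :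
    Good NB NA K (Prod.swap '' S) where
  V := by
    rintro _ ⟨p, hp, rfl⟩ m hm; exact (hS.V p hp m hm).symm
  P := by
    rintro _ ⟨p, hp, rfl⟩ m hm; exact (hS.P p hp m hm).symm
  E := by
    rintro _ ⟨p, hp, rfl⟩ _ ⟨q, hq, rfl⟩ k; exact (hS.E p hp q hq k).symm
  Es := by
    rintro _ ⟨p, hp, rfl⟩ _ ⟨q, hq, rfl⟩ k; exact (hS.Es p hp q hq k).symm
  eq := by
    rintro _ ⟨p, hp, rfl⟩ _ ⟨q, hq, rfl⟩ k; exact (hS.eq p hp q hq k).symm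

theorem Good.back {K : ℕ} {S : Set (A × B)} (hS : Good NA NB K S) (hf : S.Finite) (b : B) :
    ∃ a, Good NA NB K (Insert.insert (a, b) S) := by
  obtain ⟨a, ha⟩ := hS.swap.forth (hf.image _) b
  refine ⟨a, ?_⟩
  have := ha.swap
  rw [Set.image_insert_eq, Set.image_image] at this
  simpa using this

theorem Good.mono {K K' : ℕ} {S : Set (A × B)} (hS : Good NA NB K S) (h : K' ≤ K) :
    Good NA NB K' S :=
  ⟨fun p hp m hm => hS.V p hp m (by omega), fun p hp m hm => hS.P p hp m (by omega),
    hS.E, hS.Es, hS.eq⟩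

end Nice
/-! ### Elementary equivalence by back and forth -/

/-- The symbol `Eₙ`. -/
def rEn (n : ℕ) : L1.Relations 2 := L1Rel.En n
/-- The symbol `E`. -/
def rE : L1.Relations 2 := L1Rel.E
/-- The symbol `E⁎`. -/
def rEs : L1.Relations 2 := L1Rel.Estar
/-- The symbol `Pₘ`. -/
def rP (m : ℕ) : L1.Relations 1 := L1Rel.P m
/-- Relation symbols of `L₁` as symbols of `L₁⁺`. -/
def pR {n : ℕ} (R : L1.Relations n) : (LPlus L1).Relations n := Sum.inl R

/-- The combinatorial data describe the given structure. -/
structure Compat {A : Type u} [(LPlus L1).Structure A] (NA : Nice A) : Prop where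
  sig : ∀ x : Fin 1 → A, funMap (sigmaSymb L1) x = NA.s (x 0)
  En : ∀ (n : ℕ) (x : Fin 2 → A),
    RelMap (pR (rEn n)) x ↔ NA.V n (x 0) = NA.V n (x 1)
  E : ∀ (x : Fin 2 → A),
    RelMap (pR rE) x ↔ NA.E (x 0) (x 1)
  Es : ∀ (x : Fin 2 → A),
    RelMap (pR rEs) x ↔ NA.Es (x 0) (x 1)
  P : ∀ (m : ℕ) (x : Fin 1 → A),
    RelMap (pR (rP m)) x ↔ NA.P m (x 0)

theorem term_normal {β : Type w} (t : (LPlus L1).Term β) : ∃ (x : β) (k : ℤ),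
    ∀ (A : Type u) [(LPlus L1).Structure A] (NA : Nice A), Compat NA →
      ∀ v : β → A, t.realize v = (NA.s ^ k) (v x) := by
  induction t with
  | var x => exact ⟨x, 0, fun A _ NA _ v => by simp⟩
  | @func l f ts ih =>
    match l, f, ts, ih with
    | _, Sum.inl f, _, _ => exact f.elim
    | _, Sum.inr SigmaFunc.sigma, ts, ih =>
      obtain ⟨x, k, h⟩ := ih 0
      refine ⟨x, k + 1, fun A _ NA hA v => ?_⟩
      rw [Nice.s_add_one, ← h A NA hA v]
      exact hA.sig _

section EF

variable {A B : Type u} {α : Type w}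

/-- The pairs given by the parameters in `F` belong to `S`. -/
def Cov (F : Finset α) (v : α → A) (v' : α → B) {n : ℕ} (xs : Fin n → A) (ys : Fin n → B)
    (S : Set (A × B)) : Prop :=
  (∀ i ∈ F, (v i, v' i) ∈ S) ∧ ∀ j, (xs j, ys j) ∈ S

theorem Cov.mono {F F' : Finset α} {v : α → A} {v' : α → B} {n : ℕ} {xs : Fin n → A}
    {ys : Fin n → B} {S : Set (A × B)} (h : Cov F v v' xs ys S) (hF : F' ⊆ F) :
    Cov F' v v' xs ys S := ⟨fun i hi => h.1 i (hF hi), h.2⟩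

theorem Cov.snoc {F : Finset α} {v : α → A} {v' : α → B} {n : ℕ} {xs : Fin n → A}
    {ys : Fin n → B} {S : Set (A × B)} (h : Cov F v v' xs ys S) (a : A) (b : B) :
    Cov F v v' (Fin.snoc xs a : Fin (n + 1) → A) (Fin.snoc ys b : Fin (n + 1) → B)
      (insert (a, b) S) := by
  refine ⟨fun i hi => Or.inr (h.1 i hi), fun j => ?_⟩
  refine Fin.lastCases ?_ (fun j => ?_) j
  · simp
  · simpa using Or.inr (h.2 j)

variable [(LPlus L1).Structure A] [(LPlus L1).Structure B] {NA : Nice A} {NB : Nice B}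

open Classical in
theorem term_pair (hA : Compat NA) (hB : Compat NB) {n : ℕ} (t : (LPlus L1).Term (α ⊕ Fin n)) :
    ∃ (F : Finset α) (k : ℤ), ∀ (v : α → A) (v' : α → B) (xs : Fin n → A) (ys : Fin n → B)
      (S : Set (A × B)), Cov F v v' xs ys S → ∃ p ∈ S,
        t.realize (Sum.elim v xs) = (NA.s ^ k) p.1 ∧
          t.realize (Sum.elim v' ys) = (NB.s ^ k) p.2 := by
  obtain ⟨x, k, h⟩ := term_normal t
  rcases x with i | j
  · refine ⟨{i}, k, fun v v' xs ys S hc => ⟨_, hc.1 i (by simp), ?_, ?_⟩⟩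
    · rw [h A NA hA]; rfl
    · rw [h B NB hB]; rfl
  · refine ⟨∅, k, fun v v' xs ys S hc => ⟨_, hc.2 j, ?_, ?_⟩⟩
    · rw [h A NA hA]; rfl
    · rw [h B NB hB]; rfl

open Classical in
theorem ef (hA : Compat NA) (hB : Compat NB) (v : α → A) (v' : α → B) {n : ℕ}
    (φ : (LPlus L1).BoundedFormula α n) :
    ∃ (K : ℕ) (F : Finset α), ∀ (xs : Fin n → A) (ys : Fin n → B) (S : Set (A × B)), S.Finite →
      Nice.Good NA NB K S → Cov F v v' xs ys S → (φ.Realize v xs ↔ φ.Realize v' ys) := by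
  induction φ with
  | falsum => exact ⟨0, ∅, fun _ _ _ _ _ _ => Iff.rfl⟩
  | equal t₁ t₂ =>
    obtain ⟨F₁, k₁, h₁⟩ := term_pair hA hB t₁
    obtain ⟨F₂, k₂, h₂⟩ := term_pair hA hB t₂
    refine ⟨0, F₁ ∪ F₂, fun xs ys S _ hS hc => ?_⟩
    obtain ⟨p, hp, p1, p2⟩ := h₁ v v' xs ys S (hc.mono Finset.subset_union_left)
    obtain ⟨q, hq, q1, q2⟩ := h₂ v v' xs ys S (hc.mono Finset.subset_union_right)
    simp only [BoundedFormula.Realize, p1, p2, q1, q2]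
    rw [NA.invEq.two, NB.invEq.two, hS.eq p hp q hq]
  | @rel n l R ts =>
    match l, R, ts with
    | _, Sum.inr R, _ => exact R.elim
    | _, Sum.inl (L1Rel.En m), ts =>
      obtain ⟨F₁, k₁, h₁⟩ := term_pair hA hB (ts 0)
      obtain ⟨F₂, k₂, h₂⟩ := term_pair hA hB (ts 1)
      refine ⟨m, F₁ ∪ F₂, fun xs ys S _ hS hc => ?_⟩
      obtain ⟨p, hp, p1, p2⟩ := h₁ v v' xs ys S (hc.mono Finset.subset_union_left)
      obtain ⟨q, hq, q1, q2⟩ := h₂ v v' xs ys S (hc.mono Finset.subset_union_right)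
      change RelMap (pR (rEn m)) (fun i => (ts i).realize (Sum.elim v xs)) ↔
        RelMap (pR (rEn m)) (fun i => (ts i).realize (Sum.elim v' ys))
      rw [hA.En, hB.En, p1, p2, q1, q2,
        Nice.V_z, Nice.V_z, Nice.V_z, Nice.V_z, hS.V p hp m le_rfl, hS.V q hq m le_rfl]
    | _, Sum.inl L1Rel.E, ts =>
      obtain ⟨F₁, k₁, h₁⟩ := term_pair hA hB (ts 0)
      obtain ⟨F₂, k₂, h₂⟩ := term_pair hA hB (ts 1)
      refine ⟨0, F₁ ∪ F₂, fun xs ys S _ hS hc => ?_⟩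
      obtain ⟨p, hp, p1, p2⟩ := h₁ v v' xs ys S (hc.mono Finset.subset_union_left)
      obtain ⟨q, hq, q1, q2⟩ := h₂ v v' xs ys S (hc.mono Finset.subset_union_right)
      change RelMap (pR (rE)) (fun i => (ts i).realize (Sum.elim v xs)) ↔
        RelMap (pR (rE)) (fun i => (ts i).realize (Sum.elim v' ys))
      rw [hA.E, hB.E, p1, p2, q1, q2,
        NA.invE.two, NB.invE.two, hS.E p hp q hq]
    | _, Sum.inl L1Rel.Estar, ts =>
      obtain ⟨F₁, k₁, h₁⟩ := term_pair hA hB (ts 0)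
      obtain ⟨F₂, k₂, h₂⟩ := term_pair hA hB (ts 1)
      refine ⟨0, F₁ ∪ F₂, fun xs ys S _ hS hc => ?_⟩
      obtain ⟨p, hp, p1, p2⟩ := h₁ v v' xs ys S (hc.mono Finset.subset_union_left)
      obtain ⟨q, hq, q1, q2⟩ := h₂ v v' xs ys S (hc.mono Finset.subset_union_right)
      change RelMap (pR (rEs)) (fun i => (ts i).realize (Sum.elim v xs)) ↔
        RelMap (pR (rEs)) (fun i => (ts i).realize (Sum.elim v' ys))
      rw [hA.Es, hB.Es, p1, p2, q1, q2,
        NA.invEs.two, NB.invEs.two, hS.Es p hp q hq]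
    | _, Sum.inl (L1Rel.P m), ts =>
      obtain ⟨F₁, k₁, h₁⟩ := term_pair hA hB (ts 0)
      refine ⟨m + 1, F₁, fun xs ys S _ hS hc => ?_⟩
      obtain ⟨p, hp, p1, p2⟩ := h₁ v v' xs ys S hc
      change RelMap (pR (rP m)) (fun i => (ts i).realize (Sum.elim v xs)) ↔
        RelMap (pR (rP m)) (fun i => (ts i).realize (Sum.elim v' ys))
      rw [hA.P, hB.P, p1, p2,
        Nice.P_z, Nice.P_z, hS.P p hp m (Nat.lt_succ_self m)]
  | imp φ ψ ih₁ ih₂ =>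
    obtain ⟨K₁, F₁, h₁⟩ := ih₁
    obtain ⟨K₂, F₂, h₂⟩ := ih₂
    refine ⟨max K₁ K₂, F₁ ∪ F₂, fun xs ys S hf hS hc => ?_⟩
    rw [BoundedFormula.realize_imp, BoundedFormula.realize_imp,
      h₁ xs ys S hf (hS.mono (le_max_left _ _)) (hc.mono Finset.subset_union_left),
      h₂ xs ys S hf (hS.mono (le_max_right _ _)) (hc.mono Finset.subset_union_right)]
  | all φ ih =>
    obtain ⟨K, F, h⟩ := ih
    refine ⟨K, F, fun xs ys S hf hS hc => ?_⟩
    rw [BoundedFormula.realize_all, BoundedFormula.realize_all]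
    constructor
    · intro H b
      obtain ⟨a, ha⟩ := hS.back hf b
      exact (h _ _ _ (hf.insert _) ha (hc.snoc a b)).1 (H a)
    · intro H a
      obtain ⟨b, hb⟩ := hS.forth hf a
      exact (h _ _ _ (hf.insert _) hb (hc.snoc a b)).2 (H b)

theorem ef_formula (hA : Compat NA) (hB : Compat NB) (f : A → B)
    (hV : ∀ x m, NA.V m x = NB.V m (f x)) (hP : ∀ x m, NA.P m x ↔ NB.P m (f x))
    (hE : ∀ x y, NA.E x y ↔ NB.E (f x) (f y)) (hEs : ∀ x y, NA.Es x y ↔ NB.Es (f x) (f y))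
    (hinj : Function.Injective f) (hs : ∀ x, f (NA.s x) = NB.s (f x))
    (v : α → A) (φ : (LPlus L1).Formula α) :
    φ.Realize v ↔ φ.Realize (f ∘ v) := by
  have hz : ∀ x (k : ℤ), f ((NA.s ^ k) x) = (NB.s ^ k) (f x) := by
    intro x
    refine Nice.zind (by simp) fun k => ?_
    rw [Nice.s_add_one, Nice.s_add_one, hs, NB.s.injective.eq_iff]
  obtain ⟨K, F, h⟩ := ef hA hB v (f ∘ v) φ
  refine h _ _ ((fun i => (v i, f (v i))) '' (F : Set α)) (F.finite_toSet.image _) ?_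
    ⟨fun i hi => ⟨i, hi, rfl⟩, fun j => j.elim0⟩
  constructor
  · rintro _ ⟨i, _, rfl⟩ m _; exact hV _ _
  · rintro _ ⟨i, _, rfl⟩ m _; exact hP _ _
  · rintro _ ⟨i, _, rfl⟩ _ ⟨j, _, rfl⟩ k
    simp only [← hz]; exact hE _ _
  · rintro _ ⟨i, _, rfl⟩ _ ⟨j, _, rfl⟩ k
    simp only [← hz]; exact hEs _ _
  · rintro _ ⟨i, _, rfl⟩ _ ⟨j, _, rfl⟩ k
    simp only [← hz]; exact hinj.eq_iff.symm

end EF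
/-! ### First-order facts about `M′` and their transfer -/

theorem relEn (n : ℕ) (x : Fin 2 → M1Point) :
    RelMap (rEn n) x ↔ ∀ i < n, (x 0).1 i = (x 1).1 i := Iff.rfl
theorem relE (x : Fin 2 → M1Point) :
    RelMap rE x ↔ (x 0).1 = (x 1).1 ∧ (x 0).2.1 = (x 1).2.1 := Iff.rfl
theorem relEs (x : Fin 2 → M1Point) :
    RelMap rEs x ↔ (x 0).1 = (x 1).1 ∧ (x 0).2.1 = (x 1).2.1 ∧ (x 0).2.2.1 = (x 1).2.2.1 :=
  Iff.rfl
theorem relP (m : ℕ) (x : Fin 1 → M1Point) : RelMap (rP m) x ↔ (x 0).2.2.1 = m := Iff.rfl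

/-- The automorphism `σ₀`: the odometer on the first coordinate. -/
def odoAut : M1Point ≃[L1] M1Point where
  toFun a := (odo true a.1, a.2)
  invFun a := (odo false a.1, a.2)
  left_inv a := Prod.ext (odo_odo true a.1) rfl
  right_inv a := Prod.ext (odo_odo false a.1) rfl
  map_fun' f := f.elim
  map_rel' {n} r x := by
    match n, r, x with
    | _, L1Rel.En m, x => exact odo_congr_iff true _ _ m
    | _, L1Rel.E, x => exact and_congr (odo_inj true _ _) Iff.rfl
    | _, L1Rel.Estar, x => exact and_congr (odo_inj true _ _) Iff.rfl
    | _, L1Rel.P m, x => exact Iff.rfl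

/-- A bound variable. -/
abbrev bv {n : ℕ} (i : Fin n) : L1.Term (Empty ⊕ Fin n) := Term.var (Sum.inr i)

/-- Atomic formula for a binary relation symbol. -/
abbrev at2 (r : L1.Relations 2) {n : ℕ} (i j : Fin n) : L1.BoundedFormula Empty n :=
  r.boundedFormula₂ (bv i) (bv j)

/-- Atomic formula for a unary relation symbol. -/
abbrev at1 (r : L1.Relations 1) {n : ℕ} (i : Fin n) : L1.BoundedFormula Empty n :=
  r.boundedFormula₁ (bv i)


section facts

variable {A : Type u} [L1.Structure A]

theorem f_refl (c : M1Point ↪ₑ[L1] A) (r : L1.Relations 2)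
    (h : ∀ x : M1Point, RelMap r ![x, x]) (x : A) : RelMap r ![x, x] := by
  have := (c.map_sentence (∀' (at2 r 0 0))).1
    (by simpa [Sentence.Realize, Formula.Realize, Fin.snoc] using h)
  simp [Sentence.Realize, Formula.Realize, Fin.snoc] at this
  exact this x

theorem f_symm (c : M1Point ↪ₑ[L1] A) (r : L1.Relations 2)
    (h : ∀ x y : M1Point, RelMap r ![x, y] → RelMap r ![y, x])
    (x y : A) : RelMap r ![x, y] → RelMap r ![y, x] := by
  have := (c.map_sentence (∀' ∀' (at2 r 0 1 ⟹ at2 r 1 0))).1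
    (by simpa [Sentence.Realize, Formula.Realize, Fin.snoc] using h)
  simp [Sentence.Realize, Formula.Realize, Fin.snoc] at this
  exact this x y

theorem f_sub (c : M1Point ↪ₑ[L1] A) (r r' : L1.Relations 2)
    (h : ∀ x y : M1Point, RelMap r ![x, y] → RelMap r' ![x, y])
    (x y : A) : RelMap r ![x, y] → RelMap r' ![x, y] := by
  have := (c.map_sentence (∀' ∀' (at2 r 0 1 ⟹ at2 r' 0 1))).1
    (by simpa [Sentence.Realize, Formula.Realize, Fin.snoc] using h)
  simp [Sentence.Realize, Formula.Realize, Fin.snoc] at this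
  exact this x y

theorem f_all (c : M1Point ↪ₑ[L1] A) (r : L1.Relations 2)
    (h : ∀ x y : M1Point, RelMap r ![x, y]) (x y : A) : RelMap r ![x, y] := by
  have := (c.map_sentence (∀' ∀' (at2 r 0 1))).1
    (by simpa [Sentence.Realize, Formula.Realize, Fin.snoc] using h)
  simp [Sentence.Realize, Formula.Realize, Fin.snoc] at this
  exact this x y

theorem f_trans (c : M1Point ↪ₑ[L1] A) (r : L1.Relations 2)
    (h : ∀ x y z : M1Point, RelMap r ![x, y] → RelMap r ![y, z] → RelMap r ![x, z])
    (x y z : A) : RelMap r ![x, y] → RelMap r ![y, z] → RelMap r ![x, z] := by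
  have := (c.map_sentence (∀' ∀' ∀' (at2 r 0 1 ⟹ at2 r 1 2 ⟹ at2 r 0 2))).1
    (by simpa [Sentence.Realize, Formula.Realize, Fin.snoc] using h)
  simp [Sentence.Realize, Formula.Realize, Fin.snoc] at this
  exact this x y z

theorem f_split (c : M1Point ↪ₑ[L1] A) (r r' : L1.Relations 2)
    (h : ∀ x y z : M1Point, RelMap r ![x, y] → RelMap r ![x, z] → ¬ RelMap r' ![y, z] →
      ¬ RelMap r' ![x, y] → RelMap r' ![x, z])
    (x y z : A) : RelMap r ![x, y] → RelMap r ![x, z] → ¬ RelMap r' ![y, z] →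
      ¬ RelMap r' ![x, y] → RelMap r' ![x, z] := by
  have := (c.map_sentence
      (∀' ∀' ∀' (at2 r 0 1 ⟹ at2 r 0 2 ⟹ ∼(at2 r' 1 2) ⟹ ∼(at2 r' 0 1) ⟹ at2 r' 0 2))).1
    (by simpa [Sentence.Realize, Formula.Realize, Fin.snoc] using h)
  simp [Sentence.Realize, Formula.Realize, Fin.snoc] at this
  exact this x y z

theorem f_PEs (c : M1Point ↪ₑ[L1] A) (r : L1.Relations 2) (p : L1.Relations 1)
    (h : ∀ x y : M1Point, RelMap r ![x, y] → RelMap p ![x] → RelMap p ![y])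
    (x y : A) : RelMap r ![x, y] → RelMap p ![x] → RelMap p ![y] := by
  have := (c.map_sentence (∀' ∀' (at2 r 0 1 ⟹ at1 p 0 ⟹ at1 p 1))).1
    (by simpa [Sentence.Realize, Formula.Realize, Fin.snoc] using h)
  simp [Sentence.Realize, Formula.Realize, Fin.snoc] at this
  exact this x y

theorem f_PE (c : M1Point ↪ₑ[L1] A) (r r' : L1.Relations 2) (p : L1.Relations 1)
    (h : ∀ x y : M1Point, RelMap r ![x, y] → RelMap p ![x] → RelMap p ![y] → RelMap r' ![x, y])
    (x y : A) : RelMap r ![x, y] → RelMap p ![x] → RelMap p ![y] → RelMap r' ![x, y] := by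
  have := (c.map_sentence (∀' ∀' (at2 r 0 1 ⟹ at1 p 0 ⟹ at1 p 1 ⟹ at2 r' 0 1))).1
    (by simpa [Sentence.Realize, Formula.Realize, Fin.snoc] using h)
  simp [Sentence.Realize, Formula.Realize, Fin.snoc] at this
  exact this x y

theorem f_disj (c : M1Point ↪ₑ[L1] A) (p q : L1.Relations 1)
    (h : ∀ x : M1Point, RelMap p ![x] → ¬ RelMap q ![x])
    (x : A) : RelMap p ![x] → ¬ RelMap q ![x] := by
  have := (c.map_sentence (∀' (at1 p 0 ⟹ ∼(at1 q 0)))).1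
    (by simpa [Sentence.Realize, Formula.Realize, Fin.snoc] using h)
  simp [Sentence.Realize, Formula.Realize, Fin.snoc] at this
  exact this x

theorem f_Pex (c : M1Point ↪ₑ[L1] A) (r : L1.Relations 2) (p : L1.Relations 1)
    (h : ∀ x : M1Point, ∃ y, RelMap r ![x, y] ∧ RelMap p ![y])
    (x : A) : ∃ y, RelMap r ![x, y] ∧ RelMap p ![y] := by
  have := (c.map_sentence (∀' ∃' (at2 r 0 1 ⊓ at1 p 1))).1
    (by simpa [Sentence.Realize, Formula.Realize, Fin.snoc] using h)
  simp [Sentence.Realize, Formula.Realize, Fin.snoc] at this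
  exact this x

theorem f_two (c : M1Point ↪ₑ[L1] A) (r : L1.Relations 2)
    (h : ∀ x : M1Point, ∃ y, RelMap r ![x, y] ∧ ¬ y = x)
    (x : A) : ∃ y, RelMap r ![x, y] ∧ ¬ y = x := by
  have := (c.map_sentence (∀' ∃' (at2 r 0 1 ⊓ ∼(bv 1 =' bv 0)))).1
    (by simpa [Sentence.Realize, Formula.Realize, Fin.snoc] using h)
  simp [Sentence.Realize, Formula.Realize, Fin.snoc] at this
  exact this x

theorem f_uniq (c : M1Point ↪ₑ[L1] A) (r : L1.Relations 2)
    (h : ∀ x y z : M1Point, RelMap r ![x, y] → RelMap r ![x, z] → ¬ y = x → ¬ z = x → y = z)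
    (x y z : A) : RelMap r ![x, y] → RelMap r ![x, z] → ¬ y = x → ¬ z = x → y = z := by
  have := (c.map_sentence (∀' ∀' ∀' (at2 r 0 1 ⟹ at2 r 0 2 ⟹ ∼(bv 1 =' bv 0) ⟹
      ∼(bv 2 =' bv 0) ⟹ (bv 1 =' bv 2)))).1
    (by simpa [Sentence.Realize, Formula.Realize, Fin.snoc] using h)
  simp [Sentence.Realize, Formula.Realize, Fin.snoc] at this
  exact this x y z

theorem f_c (c : M1Point ↪ₑ[L1] A) (r : L1.Relations 2) (a b : M1Point) :
    RelMap r ![c a, c b] ↔ RelMap r ![a, b] := by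
  rw [← c.map_rel r ![a, b] ]
  have : c ∘ ![a, b] = ![c a, c b] := by ext i; fin_cases i <;> rfl
  rw [this]

theorem f_near (c : M1Point ↪ₑ[L1] A) (n : ℕ) (x : A) :
    ∃ a : M1Point, RelMap (rEn n) ![x, c a] := by
  induction n with
  | zero =>
    exact ⟨Classical.arbitrary _, f_all c (rEn 0) (fun x y => by simp [relEn]) _ _⟩
  | succ n ih =>
    obtain ⟨a, ha⟩ := ih
    by_cases h : RelMap (rEn (n + 1)) ![x, c a]
    · exact ⟨a, h⟩
    let b : M1Point := (Function.update a.1 n (!a.1 n), a.2)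
    have hb : ∀ i, b.1 i = Function.update a.1 n (!a.1 n) i := fun _ => rfl
    have hab : RelMap (rEn n) ![a, b] := by
      rw [relEn]
      intro i hi
      change a.1 i = b.1 i
      rw [hb, Function.update_of_ne (by omega)]
    have hab' : ¬ RelMap (rEn (n + 1)) ![a, b] := by
      rw [relEn]
      intro hh
      have := hh n (by omega)
      change a.1 n = b.1 n at this
      rw [hb] at this
      simp at this
    refine ⟨b, f_split c (rEn n) (rEn (n + 1)) ?_ x (c a) (c b) ha ?_ ?_ h⟩
    · intro x y z h1 h2 h3 h4
      rw [relEn] at *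
      change ∀ i < n, x.1 i = y.1 i at h1
      change ∀ i < n, x.1 i = z.1 i at h2
      change ¬ ∀ i < n + 1, y.1 i = z.1 i at h3
      change ¬ ∀ i < n + 1, x.1 i = y.1 i at h4
      change ∀ i < n + 1, x.1 i = z.1 i
      have e3 : y.1 n ≠ z.1 n := by
        intro e
        refine h3 fun i hi => ?_
        rcases Nat.lt_succ_iff_lt_or_eq.1 hi with hi | rfl
        · rw [← h1 i hi, h2 i hi]
        · exact e
      have e4 : x.1 n ≠ y.1 n := by
        intro e
        refine h4 fun i hi => ?_
        rcases Nat.lt_succ_iff_lt_or_eq.1 hi with hi | rfl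
        · exact h1 i hi
        · exact e
      intro i hi
      rcases Nat.lt_succ_iff_lt_or_eq.1 hi with hi | rfl
      · exact h2 i hi
      · revert e3 e4
        cases x.1 i <;> cases y.1 i <;> cases z.1 i <;> simp
    · refine f_trans c (rEn n) ?_ _ _ _ ha ((f_c c _ _ _).2 hab)
      intro x y z h1 h2
      rw [relEn] at *
      intro i hi
      exact (h1 i hi).trans (h2 i hi)
    · rwa [f_c]

theorem En_eqv (c : M1Point ↪ₑ[L1] A) (n : ℕ) :
    Equivalence (fun x y : A => RelMap (rEn n) ![x, y]) where
  refl := f_refl c (rEn n) fun x => by simp [relEn]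
  symm := @fun x y => f_symm c (rEn n) (fun x y h i hi => (h i hi).symm) x y
  trans := @fun x y z => f_trans c (rEn n) (fun x y z h h' i hi => (h i hi).trans (h' i hi)) x y z

theorem E_eqv (c : M1Point ↪ₑ[L1] A) : Equivalence (fun x y : A => RelMap rE ![x, y]) where
  refl := f_refl c rE fun x => by simp [relE]
  symm := @fun x y => f_symm c rE (fun x y h => ⟨h.1.symm, h.2.symm⟩) x y
  trans := @fun x y z => f_trans c rE
    (fun x y z h h' => ⟨h.1.trans h'.1, h.2.trans h'.2⟩) x y z

theorem Es_eqv (c : M1Point ↪ₑ[L1] A) : Equivalence (fun x y : A => RelMap rEs ![x, y]) where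
  refl := f_refl c rEs fun x => by simp [relEs]
  symm := @fun x y => f_symm c rEs (fun x y h => ⟨h.1.symm, h.2.1.symm, h.2.2.symm⟩) x y
  trans := @fun x y z => f_trans c rEs
    (fun x y z h h' => ⟨h.1.trans h'.1, h.2.1.trans h'.2.1, h.2.2.trans h'.2.2⟩) x y z

/-- The residue of an element modulo `2 ^ n`. -/
noncomputable def VV (c : M1Point ↪ₑ[L1] A) (n : ℕ) (x : A) : ZMod (2 ^ n) :=
  val (f_near c n x).choose.1 n

theorem VV_eq (c : M1Point ↪ₑ[L1] A) (n : ℕ) (x : A) (a : M1Point)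
    (h : RelMap (rEn n) ![x, c a]) : VV c n x = val a.1 n := by
  have h1 := (f_near c n x).choose_spec
  have h2 := (En_eqv c n).trans ((En_eqv c n).symm h1) h
  rw [f_c] at h2
  exact (val_inj _ _ _).2 h2

theorem VV_iff (c : M1Point ↪ₑ[L1] A) (n : ℕ) (x y : A) :
    RelMap (rEn n) ![x, y] ↔ VV c n x = VV c n y := by
  obtain ⟨a, ha⟩ := f_near c n x
  obtain ⟨b, hb⟩ := f_near c n y
  rw [VV_eq c n x a ha, VV_eq c n y b hb, val_inj]
  constructor
  · intro h
    have h2 := (En_eqv c n).trans ((En_eqv c n).symm ha) ((En_eqv c n).trans h hb)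
    rw [f_c] at h2
    exact h2
  · intro h
    have h2 : RelMap (rEn n) ![a, b] := h
    rw [← f_c c] at h2
    exact (En_eqv c n).trans ha ((En_eqv c n).trans h2 ((En_eqv c n).symm hb))

theorem f_partner (c : M1Point ↪ₑ[L1] A) (x : A) : ∃ y, RelMap rEs ![x, y] ∧ ¬ y = x := by
  refine f_two c rEs (fun x => ⟨(x.1, x.2.1, x.2.2.1, !x.2.2.2), ?_, ?_⟩) x
  · simp [relEs]
  · intro h
    have := congrArg (fun y : M1Point => y.2.2.2) h
    simp at this

theorem f_cz (c : M1Point ↪ₑ[L1] A) (s : Equiv.Perm A) (hc : ∀ a, s (c a) = c (odoAut a))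
    (a : M1Point) (j : ℤ) : ∃ b : M1Point, (s ^ j) (c a) = c b ∧ b.2 = a.2 := by
  revert j
  refine Nice.zind ⟨a, by simp, rfl⟩ fun j => ?_
  have e : (s ^ (j + 1)) (c a) = s ((s ^ j) (c a)) := by
    rw [add_comm, zpow_add, zpow_one]; rfl
  rw [e]
  constructor
  · rintro ⟨b, hb, hb'⟩
    exact ⟨odoAut b, by rw [hb, hc], hb'⟩
  · rintro ⟨b, hb, hb'⟩
    refine ⟨odoAut.symm b, s.injective ?_, hb'⟩
    rw [hb, hc]
    exact congrArg c (odoAut.apply_symm_apply b).symm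

/-- The combinatorial data of a model. -/
noncomputable def mkNice (c : M1Point ↪ₑ[L1] A) (s : Equiv.Perm A)
    (hs2 : ∀ (R : L1.Relations 2) x y, RelMap R ![s x, s y] ↔ RelMap R ![x, y])
    (hs1 : ∀ (R : L1.Relations 1) x, RelMap R ![s x] ↔ RelMap R ![x])
    (hc : ∀ a, s (c a) = c (odoAut a)) : Nice A where
  s := s
  V := VV c
  E x y := RelMap rE ![x, y]
  Es x y := RelMap rEs ![x, y]
  P m x := RelMap (rP m) ![x]
  pt x := (f_partner c x).choose
  cst η k := c (η, k, 0, false)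
  eqE := E_eqv c
  eqEs := Es_eqv c
  Es_E := f_sub c _ _ fun x y h => ⟨h.1, h.2.1⟩
  E_V x y n h := by
    rw [← VV_iff]
    exact f_sub c rE (rEn n) (fun x y h i _ => congrFun h.1 i) x y h
  V_s x n := by
    obtain ⟨a, ha⟩ := f_near c n x
    have h2 := (hs2 _ _ _).2 ha
    rw [hc] at h2
    rw [VV_eq c n x a ha, VV_eq c n _ _ h2]
    exact val_odo _ _
  E_s := hs2 _
  Es_s := hs2 _
  P_s m := hs1 _
  P_Es m := f_PEs c _ _ fun x y h h' => by
    have e : x.2.2.1 = y.2.2.1 := h.2.2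
    have e' : x.2.2.1 = m := h'
    exact e.symm.trans e'
  P_E m := f_PE c _ _ _ fun x y h h1 h2 => by
    have e1 : x.2.2.1 = m := h1
    have e2 : y.2.2.1 = m := h2
    exact ⟨h.1, h.2, e1.trans e2.symm⟩
  P_disj m k x h h' := by
    by_contra hne
    refine f_disj c (rP m) (rP k) (fun x h h' => hne ?_) x h h'
    have e1 : x.2.2.1 = m := h
    have e2 : x.2.2.1 = k := h'
    exact e1.symm.trans e2
  P_ex m := f_Pex c _ _ fun x => ⟨(x.1, x.2.1, m, false), ⟨rfl, rfl⟩, rfl⟩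
  Es_pt x y := by
    have hp := (f_partner c x).choose_spec
    constructor
    · intro h
      by_cases e : y = x
      · exact Or.inl e
      · refine Or.inr (f_uniq c rEs ?_ x _ _ h hp.1 e hp.2)
        intro x y z h1 h2 n1 n2
        obtain ⟨a1, a2, a3⟩ := (relEs _).1 h1
        obtain ⟨b1, b2, b3⟩ := (relEs _).1 h2
        clear h1 h2
        obtain ⟨x1, x2, x3, x4⟩ := x
        obtain ⟨y1, y2, y3, y4⟩ := y
        obtain ⟨z1, z2, z3, z4⟩ := z
        replace a1 : x1 = y1 := a1
        replace a2 : x2 = y2 := a2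
        replace a3 : x3 = y3 := a3
        replace b1 : x1 = z1 := b1
        replace b2 : x2 = z2 := b2
        replace b3 : x3 = z3 := b3
        subst a1 a2 a3 b1 b2 b3
        have n1 : ¬ y4 = x4 := fun e => n1 (by rw [e])
        have n2 : ¬ z4 = x4 := fun e => n2 (by rw [e])
        have : y4 = z4 := by revert n1 n2; cases x4 <;> cases y4 <;> cases z4 <;> simp
        rw [this]
    · rintro (rfl | rfl)
      · exact (Es_eqv c).refl _
      · exact hp.1
  pt_ne x := (f_partner c x).choose_spec.2
  V_cst η k n := VV_eq c n _ _ ((En_eqv c n).refl _)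
  cst_ne η k θ l j h := by
    obtain ⟨b, hb, hb'⟩ := f_cz c s hc (θ, l, 0, false) j
    rw [hb] at h
    replace h := (f_c c rE _ b).1 h
    have h1 : k = b.2.1 := h.2
    rw [h1, hb']
  V_sur x K := by
    obtain ⟨a, ha⟩ := f_near c K x
    refine ⟨a.1, fun m hm => VV_eq c m x a ?_⟩
    exact f_sub c (rEn K) (rEn m) (fun x y h i hi => h i (by omega)) _ _ ha

end facts
/-! ### Models of the theory -/

/-- The language `L₁⁺` with constants for `M′`. -/
abbrev LM : Language := (LPlus L1)[[M1Point]]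

/-! ### Realization of simple sentences in an arbitrary language -/

theorem gen_rel {L : Language} {M : Type*} [L.Structure M] {n : ℕ} (R : L.Relations n)
    (c : Fin n → L.Constants) :
    M ⊨ (Relations.boundedFormula R (fun i => (c i).term) : L.Sentence) ↔
      RelMap R (fun i => (c i : M)) := by
  simp only [Sentence.Realize, Formula.Realize, BoundedFormula.realize_rel,
      Term.realize_constants]

theorem gen_eq {L : Language} {M : Type*} [L.Structure M] (c d : L.Constants) :
    M ⊨ (Term.bdEqual c.term d.term : L.Sentence) ↔ (c : M) = (d : M) := by
  simp only [Sentence.Realize, Formula.Realize, BoundedFormula.realize_bdEqual,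
      Term.realize_constants]

theorem gen_app {L : Language} {M : Type*} [L.Structure M] (F : L.Functions 1)
    (c d : L.Constants) :
    M ⊨ (Term.bdEqual c.term (F.apply₁ d.term) : L.Sentence) ↔ (c : M) = funMap F ![(d : M)] := by
  simp only [Sentence.Realize, Formula.Realize, BoundedFormula.realize_bdEqual,
      Term.realize_constants, Term.realize_functions_apply₁]

theorem gen_app' {L : Language} {M : Type*} [L.Structure M] (F : L.Functions 1)
    (c d : L.Constants) :
    M ⊨ (Term.equal (F.apply₁ d.term) c.term : L.Sentence) ↔ funMap F ![(d : M)] = (c : M) := by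
  simp only [Sentence.Realize, Formula.realize_equal,
      Term.realize_constants, Term.realize_functions_apply₁]

theorem gen_pres {L : Language} {M : Type*} [L.Structure M] {n : ℕ} (R : L.Relations n)
    (F : L.Functions 1) :
    M ⊨ (BoundedFormula.alls
      ((Relations.boundedFormula R fun i => Term.var (Sum.inr i)) ⇔
        Relations.boundedFormula R fun i => F.apply₁ (Term.var (Sum.inr i))) : L.Sentence) ↔
      ∀ x : Fin n → M, RelMap R x ↔ RelMap R (fun i => funMap F ![x i]) := by
  simp [Sentence.Realize, BoundedFormula.realize_alls, Term.realize_functions_apply₁,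
    BoundedFormula.realize_rel]

theorem realize_sigmaInj {A : Type u} [(LPlus L1).Structure A] :
    A ⊨ sigmaInj L1 ↔ Function.Injective (sigmaMap L1 A) := by
  simp [sigmaInj, sigmaTerm, Sentence.Realize, Formula.Realize, Fin.snoc, sigmaMap,
    Function.Injective, Term.realize_functions_apply₁]

theorem realize_sigmaSurj {A : Type u} [(LPlus L1).Structure A] :
    A ⊨ sigmaSurj L1 ↔ Function.Surjective (sigmaMap L1 A) := by
  simp [sigmaSurj, sigmaTerm, Sentence.Realize, Formula.Realize, Fin.snoc, sigmaMap,
    Function.Surjective, Term.realize_functions_apply₁]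

theorem realize_relPres {A : Type u} [(LPlus L1).Structure A] {n : ℕ} (R : L1.Relations n) :
    A ⊨ relPresSentence L1 R ↔
      ∀ x : Fin n → A, RelMap (pR R) x ↔ RelMap (pR R) (fun i => sigmaMap L1 A (x i)) := by
  exact gen_pres (L := LPlus L1) (pR R) (sigmaSymb L1)

/-- The interpretation of the constants. -/
def cc (A : Type u) [LM.Structure A] (a : M1Point) : A := (((LPlus L1).con a : LM.Constants) : A)

theorem model_data (A : Type u) [iM : LM.Structure A] (h : A ⊨ TautDiag odoAut) :
    letI i0 : (LPlus L1).Structure A := ((LPlus L1).lhomWithConstants M1Point).reduct A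
    ∃ NA : Nice A, Compat NA ∧ (∀ n x, ∃ a, RelMap (pR (rEn n)) ![x, cc A a]) ∧
      (∀ n x a, RelMap (pR (rEn n)) ![x, cc A a] → NA.V n x = val a.1 n) := by
  letI i0 : (LPlus L1).Structure A := ((LPlus L1).lhomWithConstants M1Point).reduct A
  letI i1 : L1.Structure A := (LHom.sumInl : L1 →ᴸ LPlus L1).reduct A
  letI i2 : L1[[M1Point]].Structure A :=
    ((LHom.sumInl : L1 →ᴸ LPlus L1).addConstants M1Point).reduct A
  haveI i3 : (L1.lhomWithConstants M1Point).IsExpansionOn A :=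
    ⟨fun f _ => f.elim, fun _ _ => rfl⟩
  have h1 : A ⊨ Taut (L1.completeTheory M1Point) :=
    (LHom.onTheory_model ((LPlus L1).lhomWithConstants M1Point) _).1
      (h.mono (fun φ hφ => Or.inl (Or.inl hφ)))
  haveI h2 : A ⊨ L1.elementaryDiagram M1Point :=
    (LHom.onTheory_model ((LHom.sumInl : L1 →ᴸ LPlus L1).addConstants M1Point) _).1
      (h.mono (fun φ hφ => Or.inl (Or.inr hφ)))
  let c : M1Point ↪ₑ[L1] A := ElementaryEmbedding.ofModelsElementaryDiagram L1 M1Point A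
  have hcc : ∀ a, c a = cc A a := fun a => by
    rfl
  have hinj : Function.Injective (sigmaMap L1 A) :=
    realize_sigmaInj.1 (h1.realize_of_mem _ (Or.inl (Or.inl (Or.inr (Or.inl rfl)))))
  have hsur : Function.Surjective (sigmaMap L1 A) :=
    realize_sigmaSurj.1 (h1.realize_of_mem _ (Or.inl (Or.inl (Or.inr (Or.inr rfl)))))
  have hrel : ∀ {n : ℕ} (R : L1.Relations n) (x : Fin n → A),
      RelMap (pR R) x ↔ RelMap (pR R) (fun i => sigmaMap L1 A (x i)) := fun R =>
    (realize_relPres R).1 (h1.realize_of_mem _ (Or.inr ⟨_, R, rfl⟩))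
  have hsc : ∀ a, sigmaMap L1 A (cc A a) = cc A (odoAut a) := fun a => by
    have := h.realize_of_mem (sigmaConstSentence odoAut a) (Or.inr ⟨a, rfl⟩)
    exact (gen_app' (L := LM) (Sum.inl (sigmaSymb L1)) ((LPlus L1).con (odoAut a))
      ((LPlus L1).con a)).1 this
  let s : Equiv.Perm A := Equiv.ofBijective _ ⟨hinj, hsur⟩
  have hpR : ∀ {n : ℕ} (R : L1.Relations n) (x : Fin n → A), RelMap (pR R) x ↔ RelMap R x :=
    fun _ _ => Iff.rfl
  have e1 : ∀ x : Fin 1 → A, x = ![x 0] := fun x => by ext i; fin_cases i; rfl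
  have e2 : ∀ x : Fin 2 → A, x = ![x 0, x 1] := fun x => by ext i; fin_cases i <;> rfl
  let NA := mkNice c s
    (fun R x y => by
      rw [← hpR, ← hpR, hrel R ![x, y], e2 (fun i => sigmaMap L1 A (![x, y] i))]; rfl)
    (fun R x => by
      rw [← hpR, ← hpR, hrel R ![x], e1 (fun i => sigmaMap L1 A (![x] i))]; rfl)
    (fun a => by rw [hcc, hcc]; exact hsc a)
  refine ⟨NA, ⟨?_, ?_, ?_, ?_, ?_⟩, ?_, ?_⟩
  · intro x
    rw [e1 x]; rfl
  · intro n x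
    rw [e2 x]
    exact VV_iff c n _ _
  · intro x
    rw [e2 x]; rfl
  · intro x
    rw [e2 x]; rfl
  · intro n x
    rw [e1 x]; rfl
  · intro n x
    exact f_near c n x
  · intro n x a hx
    exact VV_eq c n x a hx

theorem sentence_iff (A B : Type u) [LM.Structure A] [LM[[A]].Structure B]
    (hA : A ⊨ TautDiag odoAut)
    (hB : B ⊨ (LM.lhomWithConstants A).onTheory (TautDiag odoAut) ∪ atomicDiagram LM A)
    (φ : LM[[A]].Sentence) : A ⊨ φ ↔ B ⊨ φ := by
  letI j : LM.Structure B := (LM.lhomWithConstants A).reduct B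
  letI iA : (LPlus L1).Structure A := ((LPlus L1).lhomWithConstants M1Point).reduct A
  letI iB : (LPlus L1).Structure B := ((LPlus L1).lhomWithConstants M1Point).reduct B
  have hB1 : B ⊨ TautDiag odoAut := (LHom.onTheory_model (LM.lhomWithConstants A) _).1
      (hB.mono (fun φ hφ => Or.inl hφ))
  have hB2 : B ⊨ atomicDiagram LM A := hB.mono (fun φ hφ => Or.inr hφ)
  obtain ⟨NA, cA, nearA, VA⟩ := model_data A hA
  obtain ⟨NB, cB, nearB, VB⟩ := model_data B hB1
  let f : A → B := fun a => ((LM.con a : LM[[A]].Constants) : B)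
  -- transfer of atomic sentences
  have tr : ∀ ψ : LM[[A]].Sentence, ψ.IsAtomic → (A ⊨ ψ ↔ B ⊨ ψ) := by
    intro ψ hψ
    constructor
    · intro h
      exact hB2.realize_of_mem ψ ⟨Or.inl hψ, h⟩
    · intro h
      by_contra h'
      have := hB2.realize_of_mem (∼ψ) ⟨Or.inr ⟨ψ, hψ, rfl⟩, h'⟩
      exact this h
  have hrel : ∀ {n : ℕ} (R : L1.Relations n) (x : Fin n → A),
      RelMap (pR R) x ↔ RelMap (pR R) (fun i => f (x i)) := by
    intro n R x
    have := tr (Relations.boundedFormula (Sum.inl (Sum.inl (pR R)) : LM[[A]].Relations n)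
      (fun i => (LM.con (x i)).term)) (BoundedFormula.IsAtomic.rel _ _)
    exact (gen_rel (L := LM[[A]]) (M := A) (Sum.inl (Sum.inl (pR R))) (fun i => LM.con (x i))).symm.trans
      (this.trans
        (gen_rel (L := LM[[A]]) (M := B) (Sum.inl (Sum.inl (pR R))) (fun i => LM.con (x i))))
  have hinj : Function.Injective f := by
    intro x y hxy
    have := tr (Term.bdEqual ((LM.con x).term) ((LM.con y).term))
      (BoundedFormula.IsAtomic.equal _ _)
    simp only [Sentence.Realize, Formula.Realize, BoundedFormula.realize_bdEqual,
      Term.realize_constants] at this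
    exact this.2 hxy
  have hsig : ∀ x, f (funMap (sigmaSymb L1) ![x]) = funMap (sigmaSymb L1) ![f x] := by
    intro x
    have := tr (Term.bdEqual
      ((LM.con (funMap (sigmaSymb L1) ![x] : A)).term)
      (Functions.apply₁ (Sum.inl (Sum.inl (sigmaSymb L1)) : LM[[A]].Functions 1)
        ((LM.con x).term)))
      (BoundedFormula.IsAtomic.equal _ _)
    exact (gen_app (L := LM[[A]]) (M := B) (Sum.inl (Sum.inl (sigmaSymb L1)))
      (LM.con (funMap (sigmaSymb L1) ![x] : A)) (LM.con x)).1 (this.1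
        ((gen_app (L := LM[[A]]) (M := A) (Sum.inl (Sum.inl (sigmaSymb L1)))
          (LM.con (funMap (sigmaSymb L1) ![x] : A)) (LM.con x)).2 rfl))
  have hcst : ∀ a : M1Point, f (cc A a) = cc B a := by
    intro a
    have := tr (Term.bdEqual ((LM.con (cc A a)).term)
      (Constants.term (Sum.inl ((LPlus L1).con a) : LM[[A]].Constants)))
      (BoundedFormula.IsAtomic.equal _ _)
    exact (gen_eq (L := LM[[A]]) (M := B) (LM.con (cc A a)) (Sum.inl ((LPlus L1).con a))).1
      (this.1 ((gen_eq (L := LM[[A]]) (M := A) (LM.con (cc A a))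
        (Sum.inl ((LPlus L1).con a))).2 rfl))
  have v2 : ∀ x y : A, (fun i => f (![x, y] i)) = ![f x, f y] := fun x y => by
    ext i; fin_cases i <;> rfl
  have v1 : ∀ x : A, (fun i => f (![x] i)) = ![f x] := fun x => by
    ext i; fin_cases i; rfl
  have key := ef_formula (α := M1Point ⊕ (A ⊕ Empty)) cA cB f
    (fun x m => by
      obtain ⟨a, ha⟩ := nearA m x
      rw [VA m x a ha]
      rw [hrel, v2, hcst] at ha
      exact (VB m (f x) a ha).symm)
    (fun x m => by
      have := hrel (rP m) ![x]
      rw [v1, cA.P, cB.P] at this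
      exact this)
    (fun x y => by
      have := hrel rE ![x, y]
      rw [v2, cA.E, cB.E] at this
      exact this)
    (fun x y => by
      have := hrel rEs ![x, y]
      rw [v2, cA.Es, cB.Es] at this
      exact this)
    hinj
    (fun x => by
      have := hsig x
      rw [cA.sig, cB.sig] at this
      exact this)
    (Sum.elim (cc A) (Sum.elim id default))
    (BoundedFormula.constantsVarsEquiv (BoundedFormula.constantsVarsEquiv φ))
  have hv : f ∘ (Sum.elim (cc A) (Sum.elim id default)) =
      (Sum.elim (cc B) (Sum.elim f default) : M1Point ⊕ (A ⊕ Empty) → B) := by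
    funext i
    rcases i with a | a | a
    · exact hcst a
    · rfl
    · exact a.elim
  rw [hv] at key
  have kA := (BoundedFormula.realize_constantsVarsEquiv (L := LPlus L1) (M := A)
    (φ := BoundedFormula.constantsVarsEquiv φ) (v := Sum.elim id default)
    (xs := (default : Fin 0 → A)))
  have kB := (BoundedFormula.realize_constantsVarsEquiv (L := LPlus L1) (M := B)
    (φ := BoundedFormula.constantsVarsEquiv φ) (v := Sum.elim f default)
    (xs := (default : Fin 0 → B)))
  have kA' := (BoundedFormula.realize_constantsVarsEquiv (L := LM) (M := A)
    (φ := φ) (v := default) (xs := (default : Fin 0 → A)))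
  have kB' := (BoundedFormula.realize_constantsVarsEquiv (L := LM) (M := B)
    (φ := φ) (v := default) (xs := (default : Fin 0 → B)))
  exact (kA'.symm.trans kA.symm).trans (key.trans (kB.trans kB'))

theorem exists_automorphism_TautDiag_has_modelCompletion :
    ∃ σ₀ : M1Point ≃[L1] M1Point, ∃ Tstar : ((LPlus L1)[[M1Point]]).Theory,
      IsModelCompletion.{0, 0, u} (TautDiag σ₀) Tstar := by
  refine ⟨odoAut, TautDiag odoAut, subset_rfl, fun M => ⟨M, ⟨Embedding.refl _ _⟩⟩, fun M => ?_⟩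
  have hM : M ⊨ (LM.lhomWithConstants M).onTheory (TautDiag odoAut) ∪ atomicDiagram LM M := by
    rw [Theory.model_union_iff]
    refine ⟨(LHom.onTheory_model _ _).2 M.is_model, ⟨fun φ hφ => hφ.2⟩⟩
  refine ⟨⟨Theory.ModelType.of _ M⟩, fun φ => ?_⟩
  by_cases h : (M : Type u) ⊨ φ
  · left
    rw [Theory.models_sentence_iff]
    intro N
    exact (sentence_iff M N M.is_model N.is_model φ).1 h
  · right
    rw [Theory.models_sentence_iff]
    intro N hN
    exact h ((sentence_iff M N M.is_model N.is_model φ).2 hN)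

end ShelahE34

end FirstOrder
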